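/- arXiv:1511.08724 — 5 statements merged into one kernel-verified Lean document; each statement's English description precedes it below -/
import Mathlib

section
/- Let T be a task that is learnable under fairness, let R be a converging fair run on T, and let π be a policy occurring in R at the end of a trial such that forward(π) ⊆ backward(π). Then π is the final policy of R. -/
/-!
Formalization of the navigational reinforcement learning framework of
Ameloot & Van den Bussche, "On the convergence of cycle detection for
navigational reinforcement learning".
-/

/-- A task `T = (Q, Q₀, A, rewards, δ)`: `Q` and `A` are (finite, nonempty) types,
`start` is a nonempty set of start states, `rewards` a nonempty set of
state-action pairs and `delta` maps each state-action pair to a nonempty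
set of successor states. -/
structure NavTask (Q A : Type) where
  start : Set Q
  start_nonempty : start.Nonempty
  rewards : Set (Q × A)
  rewards_nonempty : rewards.Nonempty
  delta : Q → A → Set Q
  delta_nonempty : ∀ q a, (delta q a).Nonempty

namespace NavTask

variable {Q A : Type}

/-- The goal states of a task. -/
def goals (T : NavTask Q A) : Set Q := {q | ∃ a, (q, a) ∈ T.rewards}

/-- The reducibility layers relative to a set `S`; `layers S 0` is the layer `F₁ = S`
of the paper, and `layers S n` is the layer `F_{n+1}`. -/
def layers (T : NavTask Q A) (S : Set Q) : ℕ → Set Q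
  | 0 => S
  | n + 1 => T.layers S n ∪ {q | ∃ a, T.delta q a ⊆ T.layers S n}

/-- `S'` is reducible to `S`. -/
def ReducibleTo (T : NavTask Q A) (S' S : Set Q) : Prop := S' ⊆ ⋃ n, T.layers S n

/-- `reduce T`: the set of states reducible to the goal states. -/
def reduce (T : NavTask Q A) : Set Q := ⋃ n, T.layers T.goals n

/-- A task is reducible if all states are reducible to the goal states. -/
def Reducible (T : NavTask Q A) : Prop := T.ReducibleTo Set.univ T.goals

end NavTask

/-- A configuration `(q, π, V)`: current state, policy, working memory. -/
structure Config (Q A : Type) where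
  state : Q
  pol : Q → A
  mem : Set Q

namespace Config

variable {Q A : Type}

/-- A configuration is branching if its current state has already been visited. -/
def Branching (c : Config Q A) : Prop := c.state ∈ c.mem

/-- Applying an option `(a, q')` to a configuration: move to `q'`, record action `a`
for the departed state, and mark the departed state as visited. -/
noncomputable def apply (c : Config Q A) (a : A) (q' : Q) : Config Q A :=
  letI := Classical.decEq Q
  ⟨q', Function.update c.pol c.state a, c.mem ∪ {c.state}⟩

end Config

/-- A transition: a four-tuple (source configuration, action, chosen successor
state, target configuration). -/
structure Step (Q A : Type) where
  src : Config Q A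
  act : A
  nxt : Q
  tgt : Config Q A

namespace NavTask

variable {Q A : Type}

/-- The options of a configuration: all actions if branching, otherwise only
the action given by the policy, paired with possible successor states. -/
def opts (T : NavTask Q A) (c : Config Q A) : Set (A × Q) :=
  {p | (c.Branching ∨ p.1 = c.pol c.state) ∧ p.2 ∈ T.delta c.state p.1}

/-- Validity of a transition. -/
def ValidStep (T : NavTask Q A) (t : Step Q A) : Prop :=
  (t.act, t.nxt) ∈ T.opts t.src ∧ t.tgt = t.src.apply t.act t.nxt

/-- A reward transition. -/
def IsRewardStep (T : NavTask Q A) (t : Step Q A) : Prop :=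
  (t.src.state, t.act) ∈ T.rewards

end NavTask

/-- A finite list of transitions is a chain: each target is the next source. -/
def IsChainList {Q A : Type} (l : List (Step Q A)) : Prop :=
  ∀ i (h : i + 1 < l.length),
    (l[i]'(Nat.lt_of_succ_lt h)).tgt = (l[i + 1]'h).src

/-- The first (source) configuration of a finite chain, if any. -/
def firstSrc? {Q A : Type} (l : List (Step Q A)) : Option (Config Q A) :=
  l.head?.map Step.src

/-- The last (target, i.e. terminal) configuration of a finite chain, if any. -/
def lastTgt? {Q A : Type} (l : List (Step Q A)) : Option (Config Q A) :=
  l.getLast?.map Step.tgt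

namespace NavTask

variable {Q A : Type}

/-- A finite trial: a nonempty valid chain ending with a reward transition and
containing no other reward transitions. -/
def IsFinTrial (T : NavTask Q A) (l : List (Step Q A)) : Prop :=
  l ≠ [] ∧ IsChainList l ∧ (∀ t ∈ l, T.ValidStep t) ∧
  (∀ t ∈ l.getLast?, T.IsRewardStep t) ∧
  (∀ i (h : i + 1 < l.length), ¬ T.IsRewardStep (l[i]'(Nat.lt_of_succ_lt h)))

/-- An infinite trial: an infinite valid chain with no reward transitions. -/
def IsInfTrial (T : NavTask Q A) (g : ℕ → Step Q A) : Prop :=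
  (∀ n, T.ValidStep (g n)) ∧ (∀ n, (g n).tgt = (g (n + 1)).src) ∧
  (∀ n, ¬ T.IsRewardStep (g n))

/-- A start configuration: a start state with empty working memory. -/
def IsStartConfig (T : NavTask Q A) (c : Config Q A) : Prop :=
  c.state ∈ T.start ∧ c.mem = ∅

/-- When a trial ends with `c₁`, the next trial starts with a configuration `c₂`
whose state is a start state, with the same policy, and empty working memory. -/
def Succession (T : NavTask Q A) (c₁ c₂ : Config Q A) : Prop :=
  c₂.state ∈ T.start ∧ c₂.pol = c₁.pol ∧ c₂.mem = ∅

end NavTask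

/-- A trial is either a finite or an infinite chain of transitions. -/
inductive Trial (Q A : Type) where
  | fin : List (Step Q A) → Trial Q A
  | inf : (ℕ → Step Q A) → Trial Q A

namespace Trial

variable {Q A : Type}

/-- A trial is finite (terminates). -/
def IsFinite : Trial Q A → Prop
  | .fin _ => True
  | .inf _ => False

/-- The configuration occurring at (0-based) position `n` of a trial: sources of
the transitions, plus (for a finite trial) the terminal configuration. -/
def config? : Trial Q A → ℕ → Option (Config Q A)
  | .fin l, n =>
      if h : n < l.length then some (l[n]'h).src
      else if n = l.length then lastTgt? l else none
  | .inf g, n => some (g n).src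

/-- Position `n` of a trial is non-terminal. -/
def NonTerminal : Trial Q A → ℕ → Prop
  | .fin l, n => n < l.length
  | .inf _, _ => True

/-- The positions at which state `q` occurs in a trial. -/
def stateOccs (tr : Trial Q A) (q : Q) : Set ℕ :=
  {n | ∃ c ∈ tr.config? n, c.state = q}

end Trial

/-- Validity of a trial. -/
def NavTask.IsTrial {Q A : Type} (T : NavTask Q A) : Trial Q A → Prop
  | .fin l => T.IsFinTrial l
  | .inf g => T.IsInfTrial g

/-- A run: either an infinite sequence of finite trials, or finitely many finite
trials followed by one infinite trial. -/
inductive Run (Q A : Type) where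
  | allFin : (ℕ → List (Step Q A)) → Run Q A
  | withInf : List (List (Step Q A)) → (ℕ → Step Q A) → Run Q A

/-- Validity of a run on a task. -/
def NavTask.IsRun {Q A : Type} (T : NavTask Q A) : Run Q A → Prop
  | .allFin f =>
      (∀ n, T.IsFinTrial (f n)) ∧
      (∀ c ∈ firstSrc? (f 0), T.IsStartConfig c) ∧
      (∀ n, ∀ c₁ ∈ lastTgt? (f n), ∀ c₂ ∈ firstSrc? (f (n + 1)), T.Succession c₁ c₂) ∧
      (∀ q ∈ T.start, {n | ∃ c ∈ firstSrc? (f n), c.state = q}.Infinite)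
  | .withInf L g =>
      (∀ l ∈ L, T.IsFinTrial l) ∧ T.IsInfTrial g ∧
      (L = [] → T.IsStartConfig (g 0).src) ∧
      (∀ l ∈ L.head?, ∀ c ∈ firstSrc? l, T.IsStartConfig c) ∧
      (∀ i (h : i + 1 < L.length),
        ∀ c₁ ∈ lastTgt? (L[i]'(Nat.lt_of_succ_lt h)),
        ∀ c₂ ∈ firstSrc? (L[i + 1]'h), T.Succession c₁ c₂) ∧
      (∀ c₁ ∈ lastTgt? (L.getLast?.getD []), T.Succession c₁ (g 0).src)

namespace Run

variable {Q A : Type}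

/-- The trials of a run. -/
def trials : Run Q A → Set (Trial Q A)
  | .allFin f => {tr | ∃ n, tr = .fin (f n)}
  | .withInf L g => {tr | (∃ l ∈ L, tr = .fin l) ∨ tr = .inf g}

/-- `P` holds at infinitely many transitions (equivalently, non-terminal
configuration occurrences) of the run, restricted to trials of index `≥ i`. -/
def InfOftenFrom : Run Q A → ℕ → (Step Q A → Prop) → Prop
  | .allFin f, i, P =>
      {p : ℕ × ℕ | i ≤ p.1 ∧ ∃ h : p.2 < (f p.1).length, P ((f p.1)[p.2]'h)}.Infinite
  | .withInf L g, i, P => i ≤ L.length ∧ {n | P (g n)}.Infinite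

/-- `P` holds at infinitely many transitions of the run. -/
def InfOften (R : Run Q A) (P : Step Q A → Prop) : Prop := R.InfOftenFrom 0 P

/-- A state is stable: only finitely many non-terminal occurrences of branching
configurations containing it. -/
def Stable (R : Run Q A) (q : Q) : Prop :=
  ¬ R.InfOften (fun t => t.src.state = q ∧ t.src.Branching)

/-- All trials of the run are finite. -/
def AllFinite : Run Q A → Prop
  | .allFin _ => True
  | .withInf _ _ => False

/-- A run converges: all trials terminate (with reward) and every state
eventually becomes stable. -/
def Converges (R : Run Q A) : Prop := R.AllFinite ∧ ∀ q, R.Stable q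

/-- Only finitely many trials contain more than `k` non-terminal configurations;
equivalently, from some trial index on, every trial has at most `k`
non-terminal configurations (sources of transitions). -/
def EventuallyBounded : Run Q A → ℕ → Prop
  | .allFin f, k => {n | k < (f n).length}.Finite
  | .withInf _ _, _ => False

/-- After trial `i` there are no more branching configurations at
non-terminal positions. -/
def NoBranchingAfter : Run Q A → ℕ → Prop
  | .allFin f, i => ∀ m, i < m → ∀ t ∈ f m, ¬ t.src.Branching
  | .withInf L g, i =>
      (∀ m, i < m → ∀ l ∈ L[m]?, ∀ t ∈ l, ¬ t.src.Branching) ∧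
      (i < L.length → ∀ n, ¬ (g n).src.Branching)

/-- Trial `i` of the run terminates (is finite). -/
def TrialTerminates : Run Q A → ℕ → Prop
  | .allFin _, _ => True
  | .withInf L _, i => i < L.length

/-- `i` is the convergence-trial index: the smallest trial index such that trial `i`
terminates and after trial `i` there are no branching configurations at
non-terminal positions. -/
def IsConvIndex (R : Run Q A) (i : ℕ) : Prop :=
  R.TrialTerminates i ∧ R.NoBranchingAfter i ∧
  ∀ j < i, ¬ (R.TrialTerminates j ∧ R.NoBranchingAfter j)

/-- `π` is the policy at the end of trial `i` of the run. -/
def EndPolicyAt : Run Q A → ℕ → (Q → A) → Prop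
  | .allFin f, i, π => ∃ t ∈ (f i).getLast?, t.tgt.pol = π
  | .withInf L _, i, π => ∃ l ∈ L[i]?, ∃ t ∈ l.getLast?, t.tgt.pol = π

/-- `π` is the final policy of the run: the policy at the end of the
convergence-trial. -/
def IsFinalPolicy (R : Run Q A) (π : Q → A) : Prop :=
  ∃ i, R.IsConvIndex i ∧ R.EndPolicyAt i π

/-- `π` occurs in the run at the end of some trial. -/
def EndsPolicy (R : Run Q A) (π : Q → A) : Prop := ∃ i, R.EndPolicyAt i π

end Run

namespace NavTask

variable {Q A : Type}

/-- Fairness: every configuration occurring infinitely often at non-terminal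
positions has each of its options taken infinitely often. -/
def Fair (T : NavTask Q A) (R : Run Q A) : Prop :=
  ∀ c : Config Q A, R.InfOften (fun t => t.src = c) →
    ∀ p ∈ T.opts c,
      R.InfOften (fun t => t = ⟨c, p.1, p.2, c.apply p.1 p.2⟩)

/-- A task is learnable under fairness if every fair run on it converges. -/
def Learnable (T : NavTask Q A) : Prop :=
  ∀ R : Run Q A, T.IsRun R → T.Fair R → R.Converges

/-- `ground π`: goal states assigned a rewarding action by the policy. -/
def ground (T : NavTask Q A) (π : Q → A) : Set Q := {q | (q, π q) ∈ T.rewards}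

/-- The forward layers of a policy; `fwd π 0` is `F₁ = Q₀` of the paper. -/
def fwd (T : NavTask Q A) (π : Q → A) : ℕ → Set Q
  | 0 => T.start
  | n + 1 => T.fwd π n ∪ ⋃ q ∈ T.fwd π n \ T.ground π, T.delta q (π q)

/-- `forward π`: states reachable from the start states by following `π`. -/
def forward (T : NavTask Q A) (π : Q → A) : Set Q := ⋃ n, T.fwd π n

/-- The backward layers of a policy; `bwd π 0` is `B₁ = ground(π)` of the paper. -/
def bwd (T : NavTask Q A) (π : Q → A) : ℕ → Set Q
  | 0 => T.ground π
  | n + 1 => T.bwd π n ∪ {q | T.delta q (π q) ⊆ T.bwd π n}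

/-- `backward π`: states reduced by `π` to the goal states in `ground π`. -/
def backward (T : NavTask Q A) (π : Q → A) : Set Q := ⋃ n, T.bwd π n

/-- A (simple) path from `q` to `q'`: non-reward transitions, pairwise distinct
states. -/
def Path (T : NavTask Q A) (q q' : Q) : Prop :=
  ∃ (n : ℕ) (s : ℕ → Q) (a : ℕ → A),
    s 0 = q ∧ s n = q' ∧
    (∀ i < n, s (i + 1) ∈ T.delta (s i) (a i)) ∧
    (∀ i < n, (s i, a i) ∉ T.rewards) ∧
    (∀ i ≤ n, ∀ j ≤ n, i ≠ j → s i ≠ s j)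

/-- A state is reachable: there is a path from some start state to it. -/
def Reachable (T : NavTask Q A) (q : Q) : Prop := ∃ q₀ ∈ T.start, T.Path q₀ q

/-- A state has a path to a set `S`. -/
def HasPathTo (T : NavTask Q A) (q : Q) (S : Set Q) : Prop := ∃ q' ∈ S, T.Path q q'

end NavTask

section

variable {Q A : Type}

theorem Config.apply_pol_self (c : Config Q A) (q' : Q) :
    (c.apply (c.pol c.state) q').pol = c.pol := by
  simp [Config.apply]

namespace NavTask

theorem ValidStep.act_eq {T : NavTask Q A} {t : Step Q A} (h : T.ValidStep t)
    (hb : ¬ t.src.Branching) : t.act = t.src.pol t.src.state :=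
  h.1.1.resolve_left hb

theorem ValidStep.tgt_pol_eq {T : NavTask Q A} {t : Step Q A} (h : T.ValidStep t)
    (hb : ¬ t.src.Branching) : t.tgt.pol = t.src.pol := by
  rw [h.2, h.act_eq hb, Config.apply_pol_self]

theorem bwd_mono (T : NavTask Q A) (π : Q → A) : Monotone (T.bwd π) :=
  monotone_nat_of_le_succ fun _ => Set.subset_union_left

/-- A non-ground state in a backward layer moves to a strictly lower layer not containing it. -/
theorem exists_bwd_descent (T : NavTask Q A) {π : Q → A} {q : Q} {n : ℕ}
    (hq : q ∈ T.bwd π n) (hg : q ∉ T.ground π) :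
    ∃ k < n, T.delta q (π q) ⊆ T.bwd π k ∧ q ∉ T.bwd π k := by
  induction n with
  | zero => exact absurd hq hg
  | succ n ih =>
    by_cases h : q ∈ T.bwd π n
    · obtain ⟨k, hk, h'⟩ := ih h
      exact ⟨k, hk.trans n.lt_succ_self, h'⟩
    · exact ⟨n, n.lt_succ_self, hq.resolve_left h, h⟩

theorem delta_subset_forward (T : NavTask Q A) {π : Q → A} {q : Q}
    (hq : q ∈ T.forward π) (hg : q ∉ T.ground π) : T.delta q (π q) ⊆ T.forward π := by
  obtain ⟨n, hn⟩ := Set.mem_iUnion.1 hq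
  exact fun q' hq' => Set.mem_iUnion.2 ⟨n + 1, Or.inr (Set.mem_biUnion ⟨hn, hg⟩ hq')⟩

/-- The configuration follows `π` inside `forward π`, and its working memory avoids a backward
layer containing the current state. -/
def Descending (T : NavTask Q A) (π : Q → A) (c : Config Q A) : Prop :=
  c.pol = π ∧ c.state ∈ T.forward π ∧ ∃ n, c.state ∈ T.bwd π n ∧ Disjoint c.mem (T.bwd π n)

theorem Descending.not_branching {T : NavTask Q A} {π : Q → A} {c : Config Q A}
    (h : T.Descending π c) : ¬ c.Branching := by
  obtain ⟨-, -, n, hn, hd⟩ := h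
  exact fun hb => Set.disjoint_left.1 hd hb hn

theorem Descending.step {T : NavTask Q A} {π : Q → A} {t : Step Q A}
    (h : T.Descending π t.src) (ht : T.ValidStep t) (hr : ¬ T.IsRewardStep t) :
    T.Descending π t.tgt := by
  have hb := h.not_branching
  have hact := ht.act_eq hb
  have hpol := ht.tgt_pol_eq hb
  obtain ⟨rfl, hf, n, hn, hd⟩ := h
  have hg : t.src.state ∉ T.ground t.src.pol := fun hg => hr (by
    rw [IsRewardStep, hact]; exact hg)
  have hnxt : t.nxt ∈ T.delta t.src.state (t.src.pol t.src.state) := hact ▸ ht.1.2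
  obtain ⟨k, hk, hsub, hnot⟩ := T.exists_bwd_descent hn hg
  have hstate : t.tgt.state = t.nxt := by rw [ht.2]; rfl
  have hmem : t.tgt.mem = t.src.mem ∪ {t.src.state} := by rw [ht.2]; rfl
  refine ⟨hpol, hstate ▸ T.delta_subset_forward hf hg hnxt, k, hstate ▸ hsub hnxt, ?_⟩
  rw [hmem, Set.disjoint_union_left, Set.disjoint_singleton_left]
  exact ⟨hd.mono_right (T.bwd_mono _ hk.le), hnot⟩

theorem Descending.not_branching_of_isFinTrial {T : NavTask Q A} {π : Q → A}
    {l : List (Step Q A)} (hl : T.IsFinTrial l)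
    (h : ∀ c ∈ firstSrc? l, T.Descending π c) : ∀ t ∈ l, ¬ t.src.Branching := by
  obtain ⟨-, hc, hv, -, hr⟩ := hl
  have key : ∀ i (hi : i < l.length), T.Descending π l[i].src := by
    intro i
    induction i with
    | zero =>
      intro hi
      exact h _ (by simp [firstSrc?, List.head?_eq_getElem?, hi])
    | succ i ih =>
      intro hi
      rw [← hc i hi]
      exact (ih _).step (hv _ (List.getElem_mem _)) (hr i hi)
  intro t ht
  obtain ⟨i, hi, rfl⟩ := List.mem_iff_getElem.1 ht
  exact (key i hi).not_branching

/-- A finite trial without branching configurations does not change the policy. -/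
theorem IsFinTrial.lastTgt_pol_eq {T : NavTask Q A} {π : Q → A} {l : List (Step Q A)}
    (hl : T.IsFinTrial l) (hb : ∀ t ∈ l, ¬ t.src.Branching)
    (h : ∀ c ∈ firstSrc? l, c.pol = π) : ∀ t ∈ l.getLast?, t.tgt.pol = π := by
  obtain ⟨-, hc, hv, -, -⟩ := hl
  have key : ∀ i (hi : i < l.length), l[i].tgt.pol = π := by
    intro i
    induction i with
    | zero =>
      intro hi
      rw [(hv _ (List.getElem_mem hi)).tgt_pol_eq (hb _ (List.getElem_mem hi))]
      exact h _ (by simp [firstSrc?, List.head?_eq_getElem?, hi])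
    | succ i ih =>
      intro hi
      rw [(hv _ (List.getElem_mem hi)).tgt_pol_eq (hb _ (List.getElem_mem hi)), ← hc i hi]
      exact ih _
  intro t ht
  obtain ⟨i, hi, rfl⟩ := List.mem_iff_getElem.1 (List.mem_of_getLast? ht)
  exact key i hi

theorem IsRun.succession {T : NavTask Q A} {f : ℕ → List (Step Q A)}
    (hrun : T.IsRun (.allFin f)) {i : ℕ} {π : Q → A}
    (hend : (Run.allFin f).EndPolicyAt i π) :
    ∀ c ∈ firstSrc? (f (i + 1)), c.state ∈ T.start ∧ c.pol = π ∧ c.mem = ∅ := by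
  obtain ⟨t, ht, rfl⟩ := hend
  exact fun c hc => hrun.2.2.1 i t.tgt (Option.mem_map_of_mem _ ht) c hc

theorem IsRun.exists_endPolicyAt {T : NavTask Q A} {f : ℕ → List (Step Q A)}
    (hrun : T.IsRun (.allFin f)) (i : ℕ) : ∃ π, (Run.allFin f).EndPolicyAt i π :=
  ⟨_, _, List.getLast_mem_getLast? (hrun.1 i).1, rfl⟩

theorem IsRun.endPolicyAt_succ {T : NavTask Q A} {f : ℕ → List (Step Q A)}
    (hrun : T.IsRun (.allFin f)) {i : ℕ} {π : Q → A}
    (hend : (Run.allFin f).EndPolicyAt i π) (hb : ∀ t ∈ f (i + 1), ¬ t.src.Branching) :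
    (Run.allFin f).EndPolicyAt (i + 1) π := by
  obtain ⟨-, t, ht, -⟩ := hrun.exists_endPolicyAt (i + 1)
  exact ⟨t, ht, (hrun.1 _).lastTgt_pol_eq hb (fun c hc => (hrun.succession hend c hc).2.1) t ht⟩

theorem IsRun.endPolicyAt_of_noBranchingAfter {T : NavTask Q A} {f : ℕ → List (Step Q A)}
    (hrun : T.IsRun (.allFin f)) {i j : ℕ} (hij : i ≤ j) {π : Q → A}
    (hend : (Run.allFin f).EndPolicyAt i π) (hb : (Run.allFin f).NoBranchingAfter i) :
    (Run.allFin f).EndPolicyAt j π := by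
  induction j, hij using Nat.le_induction with
  | base => exact hend
  | succ j hj ih => exact hrun.endPolicyAt_succ ih (hb _ (Nat.lt_succ_of_le hj))

theorem IsRun.noBranchingAfter_of_forward_subset_backward {T : NavTask Q A}
    {f : ℕ → List (Step Q A)} (hrun : T.IsRun (.allFin f)) {i : ℕ} {π : Q → A}
    (hend : (Run.allFin f).EndPolicyAt i π) (hfb : T.forward π ⊆ T.backward π) :
    (Run.allFin f).NoBranchingAfter i := by
  have next : ∀ j, (Run.allFin f).EndPolicyAt j π → ∀ t ∈ f (j + 1), ¬ t.src.Branching := by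
    refine fun j hj => Descending.not_branching_of_isFinTrial (π := π) (hrun.1 _) fun c hc => ?_
    obtain ⟨hs, hp, hm⟩ := hrun.succession hj c hc
    have hf : c.state ∈ T.forward π := Set.mem_iUnion.2 ⟨0, hs⟩
    obtain ⟨n, hn⟩ := Set.mem_iUnion.1 (hfb hf)
    exact ⟨hp, hf, n, hn, hm ▸ Set.empty_disjoint _⟩
  have stays : ∀ j, i ≤ j → (Run.allFin f).EndPolicyAt j π := by
    intro j hj
    induction j, hj using Nat.le_induction with
    | base => exact hend
    | succ j _ ih => exact hrun.endPolicyAt_succ ih (next j ih)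
  intro m hm
  obtain ⟨j, rfl⟩ := Nat.exists_eq_succ_of_ne_zero (Nat.ne_zero_of_lt hm)
  exact next j (stays j (Nat.le_of_lt_succ hm))

end NavTask

theorem Run.EndPolicyAt.unique {f : ℕ → List (Step Q A)} {i : ℕ} {π ρ : Q → A}
    (hπ : (Run.allFin f).EndPolicyAt i π) (hρ : (Run.allFin f).EndPolicyAt i ρ) : π = ρ := by
  obtain ⟨t, ht, rfl⟩ := hπ
  obtain ⟨s, hs, rfl⟩ := hρ
  rw [Option.mem_unique ht hs]

end

/-- Sufficiency: a policy occurring at the end of a trial with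
`forward(π) ⊆ backward(π)` is the final policy. -/
theorem final_policy_sufficient {Q A : Type} [Fintype Q] [Fintype A]
    (T : NavTask Q A) (hlearn : T.Learnable)
    (R : Run Q A) (hrun : T.IsRun R) (hfair : T.Fair R) (hconv : R.Converges)
    (π : Q → A) (hend : R.EndsPolicy π) (hfb : T.forward π ⊆ T.backward π) :
    R.IsFinalPolicy π := by
  classical
  cases R with
  | withInf L g => exact hconv.1.elim
  | allFin f =>
    obtain ⟨i, hi⟩ := hend
    have hex : ∃ j, (Run.allFin f).NoBranchingAfter j :=
      ⟨i, hrun.noBranchingAfter_of_forward_subset_backward hi hfb⟩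
    obtain ⟨ρ, hρ⟩ := hrun.exists_endPolicyAt (Nat.find hex)
    have hle : Nat.find hex ≤ i :=
      Nat.find_min' hex (hrun.noBranchingAfter_of_forward_subset_backward hi hfb)
    have heq : ρ = π :=
      (hrun.endPolicyAt_of_noBranchingAfter hle hρ (Nat.find_spec hex)).unique hi
    exact ⟨Nat.find hex, ⟨trivial, Nat.find_spec hex, fun j hj h => Nat.find_min hex hj h.2⟩,
      heq ▸ hρ⟩
end

section
/- Let T be a task, let R be a converging fair run on T, and let π be the final policy of R. Then forward(π) ⊆ backward(π). -/
/-- A non-branching valid transition leaves the policy unchanged. -/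
theorem NavTask.ValidStep.pol_eq {Q A : Type} {T : NavTask Q A} {t : Step Q A}
    (ht : T.ValidStep t) (hb : ¬ t.src.Branching) : t.tgt.pol = t.src.pol := by
  obtain ⟨⟨h, -⟩, h2⟩ := ht
  have h' : t.act = t.src.pol t.src.state := h.resolve_left hb
  rw [h2, h']
  simp [Config.apply]

/-- In a finite trial without non-terminal branching configurations, the policy of
the first configuration is kept throughout. -/
theorem NavTask.IsFinTrial.pol_const {Q A : Type} {T : NavTask Q A} {l : List (Step Q A)}
    (hl : T.IsFinTrial l) (hb : ∀ t ∈ l, ¬ t.src.Branching) {π : Q → A}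
    (h0 : ∀ c ∈ firstSrc? l, c.pol = π) :
    ∀ t ∈ l, t.src.pol = π ∧ t.tgt.pol = π := by
  obtain ⟨-, hc, hv, -, -⟩ := hl
  have key : ∀ k (h : k < l.length), l[k].src.pol = π := by
    intro k
    induction k with
    | zero =>
      intro h
      exact h0 _ (by simp [firstSrc?, List.head?_eq_getElem?, h])
    | succ k ih =>
      intro h
      have hm : l[k] ∈ l := List.getElem_mem _
      rw [← hc k h, (hv _ hm).pol_eq (hb _ hm)]
      exact ih _
  intro t ht
  obtain ⟨k, hk, rfl⟩ := List.getElem_of_mem ht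
  exact ⟨key k hk, ((hv _ ht).pol_eq (hb _ ht)).trans (key k hk)⟩

/-- After a trial with end policy `π` beyond which nothing branches, every transition
starts and ends with policy `π`. -/
theorem NavTask.IsRun.pol_const {Q A : Type} {T : NavTask Q A} {f : ℕ → List (Step Q A)}
    (hrun : T.IsRun (.allFin f)) {i : ℕ} (hnb : (Run.allFin f).NoBranchingAfter i)
    {π : Q → A} (hπ : (Run.allFin f).EndPolicyAt i π) :
    ∀ m, i < m → ∀ t ∈ f m, t.src.pol = π ∧ t.tgt.pol = π := by
  obtain ⟨hfin, -, hsucc, -⟩ := hrun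
  have step : ∀ m, i ≤ m → (∃ t ∈ (f m).getLast?, t.tgt.pol = π) →
      ∀ t ∈ f (m + 1), t.src.pol = π ∧ t.tgt.pol = π := by
    rintro m hm ⟨s, hs, rfl⟩
    refine (hfin _).pol_const (hnb _ (by omega)) fun c hc => ?_
    exact (hsucc m s.tgt (Option.mem_map_of_mem _ hs) c hc).2.1
  have last : ∀ m, i ≤ m → ∃ t ∈ (f m).getLast?, t.tgt.pol = π := by
    intro m hm
    induction m, hm using Nat.le_induction with
    | base => exact hπ
    | succ m hm ih =>
      have hne := (hfin (m + 1)).1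
      exact ⟨_, List.getLast?_eq_some_getLast hne,
        (step m hm ih _ (List.getLast_mem hne)).2⟩
  intro m hm
  obtain ⟨k, rfl⟩ : ∃ k, m = k + 1 := ⟨m - 1, by omega⟩
  exact step k (by omega) (last k (by omega))

/-- A property holding infinitely often in a run of finite trials holds at some
transition in arbitrarily late trials. -/
theorem Run.InfOften.exists_late {Q A : Type} {f : ℕ → List (Step Q A)}
    {P : Step Q A → Prop} (h : (Run.allFin f).InfOften P) (i : ℕ) :
    ∃ m, i < m ∧ ∃ t ∈ f m, P t := by
  by_contra! hcon
  refine h (((Set.finite_Iic i).biUnion fun m _ =>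
    (Set.finite_Iio (f m).length).image (Prod.mk m)).subset ?_)
  rintro ⟨m, k⟩ ⟨-, hk, hP⟩
  have hm : m ≤ i := by
    by_contra! hlt
    exact hcon m hlt _ (List.getElem_mem hk) hP
  simp only [Set.mem_iUnion]
  exact ⟨m, hm, k, hk, rfl⟩

/-- In a fair run, the successors of a configuration occurring infinitely often occur
infinitely often, unless the transition to them is a reward transition. -/
theorem NavTask.Fair.infOften_apply {Q A : Type} {T : NavTask Q A}
    {f : ℕ → List (Step Q A)} (hrun : T.IsRun (.allFin f)) (hfair : T.Fair (.allFin f))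
    {c : Config Q A} (hc : (Run.allFin f).InfOften (fun t => t.src = c))
    {a : A} {q : Q} (ho : (a, q) ∈ T.opts c) (hr : (c.state, a) ∉ T.rewards) :
    (Run.allFin f).InfOften (fun t => t.src = c.apply a q) := by
  have h := hfair c hc (a, q) ho
  have hinj : Function.Injective (fun p : ℕ × ℕ => (p.1, p.2 + 1)) := by
    rintro ⟨a, b⟩ ⟨c, d⟩ h
    simpa using h
  refine (Set.Infinite.image hinj.injOn h).mono ?_
  rintro _ ⟨⟨m, k⟩, ⟨-, hk, hP⟩, rfl⟩
  obtain ⟨-, hch, -, hlast, -⟩ := hrun.1 m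
  simp only at hk hP
  have hlt : k + 1 < (f m).length := by
    by_contra hnot
    have hk' : k = (f m).length - 1 := by omega
    refine hr ?_
    have hrew : T.IsRewardStep ((f m)[k]) :=
      hlast _ (by simp [List.getLast?_eq_getElem?, ← hk', hk])
    rw [hP] at hrew
    exact hrew
  refine ⟨Nat.zero_le _, hlt, ?_⟩
  change (f m)[k + 1].src = _
  rw [← hch k hlt, hP]

/-- Outside `backward π`, following `π` may avoid `backward π` forever. -/
theorem NavTask.exists_notMem_backward {Q A : Type} [Finite Q] (T : NavTask Q A)
    {π : Q → A} {q : Q} (hq : q ∉ T.backward π) :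
    q ∉ T.ground π ∧ ∃ q' ∈ T.delta q (π q), q' ∉ T.backward π := by
  refine ⟨fun h => hq (Set.mem_iUnion.2 ⟨0, h⟩), ?_⟩
  by_contra! hsub
  have hmono : Monotone (T.bwd π) := monotone_nat_of_le_succ fun n => Set.subset_union_left
  obtain ⟨n, hn⟩ := hmono.directed_le.exists_mem_subset_of_finset_subset_biUnion
    (s := (Set.toFinite (T.delta q (π q))).toFinset) (by rw [Set.Finite.coe_toFinset]; exact hsub)
  exact hq (Set.mem_iUnion.2 ⟨n + 1, Or.inr (by simpa using hn)⟩)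

/-- Necessity: the final policy of a converging fair run satisfies
`forward(π) ⊆ backward(π)`. -/
theorem final_policy_necessary {Q A : Type} [Fintype Q] [Fintype A]
    (T : NavTask Q A)
    (R : Run Q A) (hrun : T.IsRun R) (hfair : T.Fair R) (hconv : R.Converges)
    (π : Q → A) (hfin : R.IsFinalPolicy π) :
    T.forward π ⊆ T.backward π := by
  cases R with
  | withInf L g => exact hconv.1.elim
  | allFin f =>
  obtain ⟨i, ⟨-, hnb, -⟩, hπ⟩ := hfin
  have hpol := hrun.pol_const hnb hπ
  have late : ∀ c, (Run.allFin f).InfOften (fun t => t.src = c) →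
      c.pol = π ∧ ¬ c.Branching := by
    intro c hc
    obtain ⟨m, hm, t, ht, rfl⟩ := hc.exists_late i
    exact ⟨(hpol m hm t ht).1, hnb m hm t ht⟩
  have next : ∀ c, (Run.allFin f).InfOften (fun t => t.src = c) → c.state ∉ T.ground π →
      ∀ q ∈ T.delta c.state (π c.state),
      (Run.allFin f).InfOften (fun t => t.src = c.apply (π c.state) q) := by
    intro c hc hg q hq
    exact hfair.infOften_apply hrun hc ⟨Or.inr (by rw [(late c hc).1]), hq⟩ hg
  have fwd : ∀ n, ∀ q ∈ T.fwd π n, ∃ c : Config Q A, c.state = q ∧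
      (Run.allFin f).InfOften (fun t => t.src = c) := by
    intro n
    induction n with
    | zero =>
      intro q hq
      refine ⟨⟨q, π, ∅⟩, rfl, ?_⟩
      have hinf := (hrun.2.2.2 q hq).sdiff (Set.finite_Iic i)
      refine (hinf.image (f := fun n => (n, 0)) (fun a _ b _ h => by simpa using h)).mono ?_
      rintro _ ⟨m, ⟨⟨c, hc, hcq⟩, hm⟩, rfl⟩
      have him : i < m := by simpa using hm
      have hlen : 0 < (f m).length := List.length_pos_of_ne_nil (hrun.1 m).1
      have hsrc : (f m)[0].src = c := by
        simpa [firstSrc?, List.head?_eq_getElem?, hlen] using hc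
      refine ⟨Nat.zero_le _, hlen, ?_⟩
      have hp := (hpol m him _ (List.getElem_mem hlen)).1
      have hmem : c.mem = ∅ := by
        obtain ⟨k, rfl⟩ : ∃ k, m = k + 1 := ⟨m - 1, by omega⟩
        have hne := (hrun.1 k).1
        exact (hrun.2.2.1 k _ (Option.mem_map_of_mem _
          (List.getLast?_eq_some_getLast hne)) c hc).2.2
      rw [hsrc] at hp
      change (f m)[0].src = _
      rw [hsrc]
      cases c
      simp_all
    | succ n ih =>
      rintro q (hq | hq)
      · exact ih q hq
      · simp only [Set.mem_iUnion] at hq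
        obtain ⟨p, ⟨hp, hg⟩, hqp⟩ := hq
        obtain ⟨c, rfl, hc⟩ := ih p hp
        exact ⟨_, rfl, next c hc hg q hqp⟩
  have avoid : ∀ k, ∀ c : Config Q A, c.memᶜ.ncard = k →
      (Run.allFin f).InfOften (fun t => t.src = c) → c.state ∈ T.backward π := by
    intro k
    induction k using Nat.strong_induction_on with
    | _ k ih =>
      rintro c rfl hc
      by_contra hq
      obtain ⟨hg, q, hqd, hqb⟩ := T.exists_notMem_backward hq
      refine hqb (ih _ ?_ (c.apply (π c.state) q) rfl (next c hc hg q hqd))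
      refine Set.ncard_lt_ncard (compl_lt_compl_iff_lt.2 ?_)
      exact ⟨Set.subset_union_left, fun h => (late c hc).2 (h (Or.inr rfl))⟩
  intro q hq
  obtain ⟨n, hn⟩ := Set.mem_iUnion.1 hq
  obtain ⟨c, rfl, hc⟩ := fwd n q hn
  exact avoid _ c rfl hc
end

section
/- If a task T = (Q, Q₀, A, rewards, δ) is learnable under fairness, then every reachable state of T has a path to goals(T). -/
/-- Every countable set `s ≠ ∅` is enumerated by a sequence repeating each element infinitely
often. -/
theorem Set.Countable.exists_seq_infinite_fibers {O : Type*} {s : Set O} (hs : s.Countable)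
    (hne : s.Nonempty) :
    ∃ e : ℕ → O, (∀ m, e m ∈ s) ∧ ∀ p ∈ s, {m | e m = p}.Infinite := by
  obtain ⟨f, rfl⟩ := hs.exists_eq_range hne
  refine ⟨fun m => f m.unpair.1, fun m => ⟨_, rfl⟩, ?_⟩
  rintro _ ⟨k, rfl⟩
  refine Set.infinite_of_injective_forall_mem (f := fun j => Nat.pair k j) ?_ ?_
  · intro i j hij
    exact (Nat.pair_eq_pair.1 hij).2
  · intro j
    simp

/-- Every system with countably many options, and at least one option in each configuration,
has a fair infinite walk from each configuration. -/
theorem exists_fair_walk {C O : Type*} [Countable O] (opts : C → Set O)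
    (hne : ∀ c, (opts c).Nonempty) (app : C → O → C) (c₀ : C) :
    ∃ (c : ℕ → C) (o : ℕ → O), c 0 = c₀ ∧
      (∀ n, o n ∈ opts (c n) ∧ c (n + 1) = app (c n) (o n)) ∧
      ∀ x, {n | c n = x}.Infinite → ∀ p ∈ opts x, {n | c n = x ∧ o n = p}.Infinite := by
  classical
  choose e he_mem he_inf using fun c =>
    (Set.to_countable (opts c)).exists_seq_infinite_fibers (hne c)
  -- Track the current configuration together with the number of visits to each configuration.
  let w : ℕ → C × (C → ℕ) := fun n => Nat.rec (c₀, fun _ => 0)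
    (fun _ s => (app s.1 (e s.1 (s.2 s.1)), Function.update s.2 s.1 (s.2 s.1 + 1))) n
  have hcount : ∀ x n, (w n).2 x = Nat.count (fun k => (w k).1 = x) n := by
    intro x n
    induction n with
    | zero => simp [w]
    | succ n ih =>
      have hw : (w (n + 1)).2 = Function.update (w n).2 (w n).1 ((w n).2 (w n).1 + 1) := rfl
      rw [Nat.count_succ, hw]
      by_cases h : (w n).1 = x
      · subst h
        simp [ih]
      · rw [Function.update_of_ne (Ne.symm h), ih, if_neg h, add_zero]
  refine ⟨fun n => (w n).1, fun n => e (w n).1 ((w n).2 (w n).1), rfl,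
    fun n => ⟨he_mem _ _, rfl⟩, ?_⟩
  intro x hx p hp
  have hinj : Function.Injective (Nat.nth fun k => (w k).1 = x) := Nat.nth_injective hx
  refine ((he_inf x p hp).image hinj.injOn).mono ?_
  rintro _ ⟨m, hm, rfl⟩
  have hvisit : (w (Nat.nth (fun k => (w k).1 = x) m)).1 = x := Nat.nth_mem_of_infinite hx m
  refine ⟨hvisit, ?_⟩
  beta_reduce
  rw [hvisit, hcount, Nat.count_nth_of_infinite hx]
  exact hm

namespace NavTask

variable {Q A : Type} (T : NavTask Q A)

/-- There is a fair infinite trial from the configuration `c`. -/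
def HasFairInfTrial (c : Config Q A) : Prop :=
  ∃ g : ℕ → Step Q A, T.IsInfTrial g ∧ (g 0).src = c ∧ T.Fair (.withInf [] g)

theorem opts_nonempty (c : Config Q A) : (T.opts c).Nonempty := by
  obtain ⟨q, hq⟩ := T.delta_nonempty c.state (c.pol c.state)
  exact ⟨(_, q), Or.inr rfl, hq⟩

theorem path_refl (q : Q) : T.Path q q := by
  obtain ⟨⟨-, a⟩, -⟩ := T.rewards_nonempty
  exact ⟨0, fun _ => q, fun _ => a, rfl, rfl, by simp, by simp, by omega⟩

variable {T}

/-- A path can be extended at its front by a non-reward transition, removing a cycle if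
necessary. -/
theorem Path.cons {q q' r : Q} {a : A} (hq' : q' ∈ T.delta q a) (ha : (q, a) ∉ T.rewards)
    (h : T.Path q' r) : T.Path q r := by
  obtain ⟨n, s, b, rfl, rfl, hd, hr, hinj⟩ := h
  by_cases hmem : ∃ k ≤ n, s k = q
  · obtain ⟨k, hk, rfl⟩ := hmem
    refine ⟨n - k, fun i => s (k + i), fun i => b (k + i), rfl, ?_, ?_, ?_, ?_⟩
    · simp only [Nat.add_sub_cancel' hk]
    · exact fun i hi => hd (k + i) (by omega)
    · exact fun i hi => hr (k + i) (by omega)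
    · exact fun i hi j hj hij => hinj (k + i) (by omega) (k + j) (by omega) (by omega)
  · push Not at hmem
    refine ⟨n + 1, fun i => Nat.casesOn i q s, fun i => Nat.casesOn i a b, rfl, rfl, ?_, ?_, ?_⟩
    · rintro (_ | i) hi
      · exact hq'
      · exact hd i (by omega)
    · rintro (_ | i) hi
      · exact ha
      · exact hr i (by omega)
    · rintro (_ | i) hi (_ | j) hj hij
      · exact absurd rfl hij
      · exact (hmem j (by omega)).symm
      · exact hmem i (by omega)
      · exact hinj i (by omega) j (by omega) (by omega)

theorem notMem_rewards_of_not_hasPathTo {q : Q} (hq : ¬ T.HasPathTo q T.goals) (a : A) :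
    (q, a) ∉ T.rewards :=
  fun h => hq ⟨q, ⟨a, h⟩, T.path_refl q⟩

theorem not_hasPathTo_of_mem_delta {q q' : Q} {a : A} (hq : ¬ T.HasPathTo q T.goals)
    (hq' : q' ∈ T.delta q a) : ¬ T.HasPathTo q' T.goals := by
  rintro ⟨r, hr, hpath⟩
  exact hq ⟨r, hr, hpath.cons hq' (notMem_rewards_of_not_hasPathTo hq a)⟩

/-- From a state without path to the goals, every fair walk is a fair infinite trial. -/
theorem hasFairInfTrial_of_not_hasPathTo [Countable Q] [Countable A] (c₀ : Config Q A)
    (h₀ : ¬ T.HasPathTo c₀.state T.goals) : T.HasFairInfTrial c₀ := by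
  obtain ⟨c, o, rfl, hstep, hfair⟩ := exists_fair_walk T.opts T.opts_nonempty
    (fun c p => c.apply p.1 p.2) c₀
  have hdead : ∀ n, ¬ T.HasPathTo (c n).state T.goals := by
    intro n
    induction n with
    | zero => exact h₀
    | succ n ih =>
      rw [(hstep n).2]
      exact not_hasPathTo_of_mem_delta ih (hstep n).1.2
  refine ⟨fun n => ⟨c n, (o n).1, (o n).2, c (n + 1)⟩, ⟨fun n => hstep n, fun n => rfl,
    fun n => notMem_rewards_of_not_hasPathTo (hdead n) _⟩, rfl, ?_⟩
  rintro x ⟨h, hx⟩ p hp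
  refine ⟨h, (hfair x hx p hp).mono ?_⟩
  rintro n ⟨rfl, rfl⟩
  simp [(hstep n).2]

/-- A fair infinite trial can be extended at its front by a non-reward transition. -/
theorem HasFairInfTrial.cons {c : Config Q A} {a : A} {q' : Q} (hopt : (a, q') ∈ T.opts c)
    (ha : (c.state, a) ∉ T.rewards) (h : T.HasFairInfTrial (c.apply a q')) :
    T.HasFairInfTrial c := by
  obtain ⟨g, ⟨hv, hchain, hr⟩, h0, hfair⟩ := h
  let g' : ℕ → Step Q A := fun n => Nat.casesOn n ⟨c, a, q', c.apply a q'⟩ g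
  have hshift : ∀ P : Step Q A → Prop, {n | P (g' n)}.Infinite ↔ {n | P (g n)}.Infinite := by
    intro P
    rw [← Nat.frequently_atTop_iff_infinite, ← Nat.frequently_atTop_iff_infinite,
      ← Filter.map_add_atTop_eq_nat 1, Filter.frequently_map, Filter.map_add_atTop_eq_nat 1]
  refine ⟨g', ⟨?_, ?_, ?_⟩, rfl, ?_⟩
  · rintro (_ | n)
    · exact ⟨hopt, rfl⟩
    · exact hv n
  · rintro (_ | n)
    · exact h0.symm
    · exact hchain n
  · rintro (_ | n)
    · exact ha
    · exact hr n
  · rintro x ⟨h, hx⟩ p hp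
    have hx' := (hshift fun t => t.src = x).1 hx
    exact ⟨h, (hshift fun t => t = ⟨x, p.1, p.2, x.apply p.1 p.2⟩).2 (hfair x ⟨h, hx'⟩ p hp).2⟩

/-- If a reachable state has no path to the goals then some start configuration has a fair
infinite trial: the initial policy leads along a path to that state. -/
theorem exists_start_hasFairInfTrial [Countable Q] [Countable A] {q : Q} (hq : T.Reachable q)
    (hdead : ¬ T.HasPathTo q T.goals) : ∃ c, T.IsStartConfig c ∧ T.HasFairInfTrial c := by
  classical
  obtain ⟨q₀, hq₀, n, s, a, rfl, rfl, hd, hr, hinj⟩ := hq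
  obtain ⟨pol, hpol⟩ : ∃ pol : Q → A, ∀ i ≤ n, pol (s i) = a i := by
    refine ⟨fun x => if h : ∃ i ≤ n, s i = x then a h.choose else a 0, fun i hi => ?_⟩
    have h : ∃ j ≤ n, s j = s i := ⟨i, hi, rfl⟩
    have heq : h.choose = i := by
      by_contra hne
      exact hinj _ h.choose_spec.1 i hi hne h.choose_spec.2
    simp only [dif_pos h, heq]
  have key : ∀ d i, i + d = n → ∀ V, T.HasFairInfTrial ⟨s i, pol, V⟩ := by
    intro d
    induction d with
    | zero =>
      rintro i rfl V
      exact hasFairInfTrial_of_not_hasPathTo _ hdead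
    | succ d ih =>
      intro i hi V
      refine HasFairInfTrial.cons (a := a i) (q' := s (i + 1))
        ⟨Or.inr (hpol i (by omega)).symm, hd i (by omega)⟩ (hr i (by omega)) ?_
      have happly : (⟨s i, pol, V⟩ : Config Q A).apply (a i) (s (i + 1)) =
          ⟨s (i + 1), pol, V ∪ {s i}⟩ := by
        simp [Config.apply, ← hpol i (by omega)]
      rw [happly]
      exact ih (i + 1) (by omega) _
  exact ⟨⟨s 0, pol, ∅⟩, ⟨hq₀, rfl⟩, key n 0 (by omega) ∅⟩

end NavTask

/-- If a task is learnable under fairness, then every reachable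
state has a path to the goal states. -/
theorem learnable_reachable_path_to_goals {Q A : Type} [Fintype Q] [Fintype A]
    (T : NavTask Q A) (hlearn : T.Learnable) :
    ∀ q : Q, T.Reachable q → T.HasPathTo q T.goals := by
  intro q hq
  by_contra hdead
  obtain ⟨c, hc, g, hg, rfl, hfair⟩ := NavTask.exists_start_hasFairInfTrial hq hdead
  refine (hlearn (.withInf [] g) ⟨by simp, hg, fun _ => hc, by simp, by simp, ?_⟩ hfair).1
  simp [lastTgt?]
end

section
/- If a task T = (Q, Q₀, A, rewards, δ) is reducible, then every state of Q has a path to goals(T). -/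
namespace NavTask

variable {Q A : Type}

theorem layers_subset_succ (T : NavTask Q A) (S : Set Q) (n : ℕ) :
    T.layers S n ⊆ T.layers S (n + 1) :=
  Set.subset_union_left

theorem subset_layers (T : NavTask Q A) (S : Set Q) (n : ℕ) : S ⊆ T.layers S n := by
  induction n with
  | zero => exact subset_rfl
  | succ n ih => exact ih.trans (T.layers_subset_succ S n)

/-- A path from `q` to `q'` all of whose states lie in `S`. -/
def PathIn (T : NavTask Q A) (S : Set Q) (q q' : Q) : Prop :=
  ∃ (n : ℕ) (s : ℕ → Q) (a : ℕ → A),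
    s 0 = q ∧ s n = q' ∧
    (∀ i < n, s (i + 1) ∈ T.delta (s i) (a i)) ∧
    (∀ i < n, (s i, a i) ∉ T.rewards) ∧
    (∀ i ≤ n, ∀ j ≤ n, i ≠ j → s i ≠ s j) ∧
    ∀ i ≤ n, s i ∈ S

namespace PathIn

variable {T : NavTask Q A} {S S' : Set Q} {q q' q'' : Q}

theorem path (h : T.PathIn S q q') : T.Path q q' := by
  obtain ⟨n, s, a, h0, hn, hδ, hr, hd, -⟩ := h
  exact ⟨n, s, a, h0, hn, hδ, hr, hd⟩

theorem mono (h : T.PathIn S q q') (hS : S ⊆ S') : T.PathIn S' q q' := by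
  obtain ⟨n, s, a, h0, hn, hδ, hr, hd, hs⟩ := h
  exact ⟨n, s, a, h0, hn, hδ, hr, hd, fun i hi => hS (hs i hi)⟩

theorem refl (hq : q ∈ S) : T.PathIn S q q := by
  obtain ⟨⟨-, a⟩, -⟩ := T.rewards_nonempty
  refine ⟨0, fun _ => q, fun _ => a, rfl, rfl, by simp, by simp, ?_, fun _ _ => hq⟩
  intro i hi j hj hij
  omega

theorem cons {a : A} (h : T.PathIn S q' q'') (hδ : q' ∈ T.delta q a)
    (hr : (q, a) ∉ T.rewards) (hq : q ∉ S) : T.PathIn (insert q S) q q'' := by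
  obtain ⟨n, s, b, rfl, hn, hδs, hrs, hd, hs⟩ := h
  refine ⟨n + 1, fun | 0 => q | i + 1 => s i, fun | 0 => a | i + 1 => b i,
    rfl, hn, ?_, ?_, ?_, ?_⟩
  · rintro (_ | i) hi
    · exact hδ
    · exact hδs i (by omega)
  · rintro (_ | i) hi
    · exact hr
    · exact hrs i (by omega)
  · rintro (_ | i) hi (_ | j) hj hij
    · exact absurd rfl hij
    · exact (ne_of_mem_of_not_mem (hs j (by omega)) hq).symm
    · exact ne_of_mem_of_not_mem (hs i (by omega)) hq
    · exact hd i (by omega) j (by omega) (by omega)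
  · rintro (_ | i) hi
    · exact Set.mem_insert q S
    · exact Set.mem_insert_of_mem q (hs i (by omega))

end PathIn

theorem exists_pathIn_layers (T : NavTask Q A) (n : ℕ) {q : Q}
    (hq : q ∈ T.layers T.goals n) :
    ∃ q' ∈ T.goals, T.PathIn (T.layers T.goals n) q q' := by
  induction n generalizing q with
  | zero => exact ⟨q, hq, .refl hq⟩
  | succ n ih =>
    by_cases hqn : q ∈ T.layers T.goals n
    · obtain ⟨g, hg, hp⟩ := ih hqn
      exact ⟨g, hg, hp.mono (T.layers_subset_succ _ n)⟩
    · obtain ⟨a, ha⟩ := hq.resolve_left hqn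
      obtain ⟨q', hq'⟩ := T.delta_nonempty q a
      obtain ⟨g, hg, hp⟩ := ih (ha hq')
      have hr : (q, a) ∉ T.rewards := fun h => hqn (T.subset_layers _ n ⟨a, h⟩)
      exact ⟨g, hg, (hp.cons hq' hr hqn).mono
        (Set.insert_subset hq (T.layers_subset_succ _ n))⟩

end NavTask

/-- In a reducible task, every state has a path to the goal
states. -/
theorem reducible_path_to_goals {Q A : Type} [Fintype Q] [Fintype A]
    (T : NavTask Q A) (hred : T.Reducible) :
    ∀ q : Q, T.HasPathTo q T.goals := by
  intro q
  obtain ⟨n, hn⟩ := Set.mem_iUnion.mp (hred (Set.mem_univ q))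
  obtain ⟨g, hg, hp⟩ := T.exists_pathIn_layers n hn
  exact ⟨g, hg, hp.path⟩
end

section
/- There exists a reducible task T and a (valid) run on T that does not converge. Hence the fairness assumption cannot be dropped from the statement that all reducible tasks are learnable under fairness. -/
/-- A single state with two self-loops, of which only the action `true` is rewarded. -/
def selfLoopTask : NavTask Unit Bool where
  start := Set.univ
  start_nonempty := Set.univ_nonempty
  rewards := {((), true)}
  rewards_nonempty := Set.singleton_nonempty _
  delta _ _ := Set.univ
  delta_nonempty _ _ := Set.univ_nonempty

/-- The `n`-th configuration when the unrewarded self-loop is always taken. -/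
def selfLoopConfig (n : ℕ) : Config Unit Bool := ⟨(), fun _ => false, {_q | 0 < n}⟩

/-- The `n`-th transition when the unrewarded self-loop is always taken. -/
def selfLoopStep (n : ℕ) : Step Unit Bool :=
  ⟨selfLoopConfig n, false, (), selfLoopConfig (n + 1)⟩

theorem selfLoopConfig_apply (n : ℕ) :
    (selfLoopConfig n).apply false () = selfLoopConfig (n + 1) := by
  simp [selfLoopConfig, Config.apply, Set.eq_univ_iff_forall]

theorem reducible_selfLoopTask : selfLoopTask.Reducible := fun _ _ =>
  Set.mem_iUnion.2 ⟨0, true, rfl⟩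

theorem isInfTrial_selfLoopStep : selfLoopTask.IsInfTrial selfLoopStep :=
  ⟨fun n => ⟨⟨Or.inr rfl, Set.mem_univ _⟩, (selfLoopConfig_apply n).symm⟩, fun _ => rfl,
    fun _ => by simp [NavTask.IsRewardStep, selfLoopTask, selfLoopStep]⟩

theorem isRun_selfLoopStep : selfLoopTask.IsRun (.withInf [] selfLoopStep) := by
  have start : selfLoopTask.IsStartConfig (selfLoopStep 0).src := by
    simp [NavTask.IsStartConfig, selfLoopTask, selfLoopStep, selfLoopConfig]
  simp [NavTask.IsRun, isInfTrial_selfLoopStep, lastTgt?, start]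

/-- There is a reducible task with a valid run that does not
converge; hence fairness cannot be dropped. -/
theorem exists_reducible_task_nonconverging_run :
    ∃ (Q A : Type) (_ : Fintype Q) (_ : Fintype A) (T : NavTask Q A) (R : Run Q A),
      T.Reducible ∧ T.IsRun R ∧ ¬ R.Converges :=
  ⟨Unit, Bool, inferInstance, inferInstance, selfLoopTask, .withInf [] selfLoopStep,
    reducible_selfLoopTask, isRun_selfLoopStep, fun h => h.1⟩
end
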